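/- arXiv:2312.03959 — 6 statements merged into one kernel-verified Lean document; each statement's English description precedes it below -/
import Mathlib

section
/- Let K be a field, Λ a τ-tilting finite finite-dimensional K-algebra, and 𝒯 a torsion class of finite-dimensional right Λ-modules. The following are equivalent: (1) pop↓(𝒯) is the zero torsion class (the class consisting only of the zero module); (2) every module in 𝒟(𝒯) is a simple Λ-module; (3) 𝒯 is closed under submodules (i.e., 𝒯 is a Serre subcategory of the category of finite-dimensional Λ-modules). -/
namespace PaperTors

universe u

variable (K : Type u) [Field K] (Λ : Type u) [Ring Λ] [Algebra K Λ]

/-- The category of finite-dimensional right `Λ`-modules is modeled as bundled left modules over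
the opposite algebra `Λᵐᵒᵖ` (a right `Λ`-module is the same thing as a left `Λᵐᵒᵖ`-module). -/
abbrev RMod := ModuleCat.{u} Λᵐᵒᵖ

/-- `M` is finite-dimensional over `K` (with the `K`-action obtained through the algebra map
`K → Λᵐᵒᵖ`). -/
def IsFinDim (M : RMod Λ) : Prop :=
  letI : Module K M := Module.compHom M (algebraMap K Λᵐᵒᵖ)
  FiniteDimensional K M

/-- `𝒯` is a torsion class of finite-dimensional right `Λ`-modules: a class of modules, closed
under isomorphism, consisting of finite-dimensional modules, containing the zero module, and
closed under quotient modules and under extensions. -/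
structure IsTorsionClass (𝒯 : Set (RMod Λ)) : Prop where
  iso_closed : ∀ M N : RMod Λ, (M ≃ₗ[Λᵐᵒᵖ] N) → M ∈ 𝒯 → N ∈ 𝒯
  finDim : ∀ M ∈ 𝒯, IsFinDim K Λ M
  zero_mem : ∀ M : RMod Λ, Subsingleton M → M ∈ 𝒯
  quot_closed : ∀ (M N : RMod Λ) (f : M →ₗ[Λᵐᵒᵖ] N), Function.Surjective f → M ∈ 𝒯 → N ∈ 𝒯
  ext_closed : ∀ (M : RMod Λ) (A : Submodule Λᵐᵒᵖ M),
    ModuleCat.of Λᵐᵒᵖ A ∈ 𝒯 → ModuleCat.of Λᵐᵒᵖ (M ⧸ A) ∈ 𝒯 → M ∈ 𝒯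

/-- The lattice of torsion classes `tors Λ`, ordered by inclusion. -/
def TorsionClass : Type (u + 1) := {𝒯 : Set (RMod Λ) // IsTorsionClass K Λ 𝒯}

instance : PartialOrder (TorsionClass K Λ) := Subtype.partialOrder _

/-- `y` is the image of `x` under the pop-stack operator: `y` is the meet (the greatest lower
bound) of the set consisting of `x` together with all elements covered by `x`. -/
def IsPopDown {α : Type*} [PartialOrder α] (x y : α) : Prop :=
  IsGLB (insert x {z | z ⋖ x}) y

/-- `y` is the image of `x` under the dual pop-stack operator: `y` is the join (the least upper
bound) of the set consisting of `x` together with all elements covering `x`. -/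
def IsPopUp {α : Type*} [PartialOrder α] (x y : α) : Prop :=
  IsLUB (insert x {z | x ⋖ z}) y

variable {K}

/-- `W_L(𝒯)`: modules `M ∈ 𝒯` such that the kernel of any homomorphism from a module of `𝒯`
to `M` again lies in `𝒯`. -/
def WLower (𝒯 : Set (RMod Λ)) : Set (RMod Λ) :=
  {M | M ∈ 𝒯 ∧ ∀ N : RMod Λ, N ∈ 𝒯 → ∀ f : N →ₗ[Λᵐᵒᵖ] M,
    ModuleCat.of Λᵐᵒᵖ (LinearMap.ker f) ∈ 𝒯}

/-- `𝒟(𝒯)`: the nonzero modules of `W_L(𝒯)` having no proper nonzero submodule belonging to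
`W_L(𝒯)` (the brick labels of the cover relations below `𝒯`). -/
def DSet (𝒯 : Set (RMod Λ)) : Set (RMod Λ) :=
  {M | M ∈ WLower Λ 𝒯 ∧ (∃ m : M, m ≠ 0) ∧
    ∀ N : Submodule Λᵐᵒᵖ M, ModuleCat.of Λᵐᵒᵖ N ∈ WLower Λ 𝒯 → N = ⊥ ∨ N = ⊤}

/-- `𝒯⊥`: the modules admitting no nonzero homomorphism from any module of `𝒯`. -/
def Perp (𝒯 : Set (RMod Λ)) : Set (RMod Λ) :=
  {M | ∀ T : RMod Λ, T ∈ 𝒯 → ∀ f : T →ₗ[Λᵐᵒᵖ] M, f = 0}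

/-- `W_U(𝒯)`: modules `M ∈ 𝒯⊥` such that the cokernel of any homomorphism from `M` to a module
of `𝒯⊥` again lies in `𝒯⊥`. -/
def WUpper (𝒯 : Set (RMod Λ)) : Set (RMod Λ) :=
  {M | M ∈ Perp Λ 𝒯 ∧ ∀ N : RMod Λ, N ∈ Perp Λ 𝒯 → ∀ f : M →ₗ[Λᵐᵒᵖ] N,
    ModuleCat.of Λᵐᵒᵖ (N ⧸ LinearMap.range f) ∈ Perp Λ 𝒯}

/-- `𝒰(𝒯)`: the nonzero modules of `W_U(𝒯)` having no proper nonzero submodule belonging to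
`W_U(𝒯)` (the brick labels of the cover relations above `𝒯`). -/
def USet (𝒯 : Set (RMod Λ)) : Set (RMod Λ) :=
  {M | M ∈ WUpper Λ 𝒯 ∧ (∃ m : M, m ≠ 0) ∧
    ∀ N : Submodule Λᵐᵒᵖ M, ModuleCat.of Λᵐᵒᵖ N ∈ WUpper Λ 𝒯 → N = ⊥ ∨ N = ⊤}

/-- `Filt(𝒞)`: modules admitting a finite filtration by submodules whose successive quotients
are isomorphic to modules in `𝒞`. -/
def FiltSet (𝒞 : Set (RMod Λ)) : Set (RMod Λ) :=
  {M | ∃ (r : ℕ) (c : Fin (r + 1) → Submodule Λᵐᵒᵖ M), Monotone c ∧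
    c 0 = ⊥ ∧ c (Fin.last r) = ⊤ ∧
    ∀ i : Fin r, ∃ C ∈ 𝒞, Nonempty
      ((↥(c i.succ) ⧸ Submodule.comap (c i.succ).subtype (c i.castSucc)) ≃ₗ[Λᵐᵒᵖ] C)}


/-! ### Basic closure properties -/

theorem IsTorsionClass.quot' {𝒯 : Set (RMod Λ)} (h : IsTorsionClass K Λ 𝒯)
    {M N : Type u} [AddCommGroup M] [Module Λᵐᵒᵖ M] [AddCommGroup N] [Module Λᵐᵒᵖ N]
    (f : M →ₗ[Λᵐᵒᵖ] N) (hf : Function.Surjective f) (hM : ModuleCat.of Λᵐᵒᵖ M ∈ 𝒯) :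
    ModuleCat.of Λᵐᵒᵖ N ∈ 𝒯 :=
  h.quot_closed (ModuleCat.of Λᵐᵒᵖ M) (ModuleCat.of Λᵐᵒᵖ N) f hf hM

theorem IsTorsionClass.range' {𝒯 : Set (RMod Λ)} (h : IsTorsionClass K Λ 𝒯)
    {M N : Type u} [AddCommGroup M] [Module Λᵐᵒᵖ M] [AddCommGroup N] [Module Λᵐᵒᵖ N]
    (f : M →ₗ[Λᵐᵒᵖ] N) (hM : ModuleCat.of Λᵐᵒᵖ M ∈ 𝒯) :
    ModuleCat.of Λᵐᵒᵖ (LinearMap.range f) ∈ 𝒯 :=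
  h.quot' Λ f.rangeRestrict f.surjective_rangeRestrict hM

theorem IsTorsionClass.ext' {𝒯 : Set (RMod Λ)} (h : IsTorsionClass K Λ 𝒯)
    {M N : Type u} [AddCommGroup M] [Module Λᵐᵒᵖ M] [AddCommGroup N] [Module Λᵐᵒᵖ N]
    (f : M →ₗ[Λᵐᵒᵖ] N) (hf : Function.Surjective f)
    (hk : ModuleCat.of Λᵐᵒᵖ (LinearMap.ker f) ∈ 𝒯) (hN : ModuleCat.of Λᵐᵒᵖ N ∈ 𝒯) :
    ModuleCat.of Λᵐᵒᵖ M ∈ 𝒯 := by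
  refine h.ext_closed (ModuleCat.of Λᵐᵒᵖ M) (LinearMap.ker f) hk ?_
  let e := f.quotKerEquivOfSurjective hf
  exact h.quot' Λ e.symm.toLinearMap e.symm.surjective hN

theorem IsFinDim.noeth {M : RMod Λ} (h : IsFinDim K Λ M) : IsNoetherian Λᵐᵒᵖ M := by
  letI : Module K M := Module.compHom M (algebraMap K Λᵐᵒᵖ)
  haveI : FiniteDimensional K M := h
  haveI : IsScalarTower K Λᵐᵒᵖ M := ⟨fun a b c => by
    rw [Algebra.smul_def, mul_smul]; rfl⟩
  exact isNoetherian_of_tower K inferInstance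

theorem IsFinDim.artin {M : RMod Λ} (h : IsFinDim K Λ M) : IsArtinian Λᵐᵒᵖ M := by
  letI : Module K M := Module.compHom M (algebraMap K Λᵐᵒᵖ)
  haveI : FiniteDimensional K M := h
  haveI : IsScalarTower K Λᵐᵒᵖ M := ⟨fun a b c => by
    rw [Algebra.smul_def, mul_smul]; rfl⟩
  exact isArtinian_of_tower K inferInstance

/-- The modules of `T` without nonzero maps to `X`. -/
def homKer (T : TorsionClass K Λ) (X : RMod Λ) : TorsionClass K Λ :=
  ⟨{M | M ∈ T.1 ∧ ∀ f : M →ₗ[Λᵐᵒᵖ] X, f = 0},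
   { iso_closed := fun M N e hM => ⟨T.2.iso_closed M N e hM.1, fun f => by
      have := hM.2 (f ∘ₗ e.toLinearMap)
      ext x
      simpa using LinearMap.congr_fun this (e.symm x)⟩
     finDim := fun M hM => T.2.finDim M hM.1
     zero_mem := fun M hM => ⟨T.2.zero_mem M hM, fun f => by
      ext x
      rw [Subsingleton.elim x 0]; simp⟩
     quot_closed := fun M N g hg hM => ⟨T.2.quot_closed M N g hg hM.1, fun f => by
      have := hM.2 (f ∘ₗ g)
      ext x
      obtain ⟨y, rfl⟩ := hg x
      exact LinearMap.congr_fun this y⟩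
     ext_closed := fun M A hA hQ => ⟨T.2.ext_closed M A hA.1 hQ.1, fun f => by
      have h1 : f ∘ₗ A.subtype = 0 := hA.2 (f ∘ₗ A.subtype)
      have h2 : A ≤ LinearMap.ker f := fun a ha => LinearMap.congr_fun h1 ⟨a, ha⟩
      have h3 : A.liftQ f h2 = 0 := hQ.2 (A.liftQ f h2)
      ext x
      exact LinearMap.congr_fun h3 (A.mkQ x)⟩ }⟩

/-- The meet of `T` and all the torsion classes covered by `T`. -/
def popD (T : TorsionClass K Λ) : TorsionClass K Λ :=
  ⟨{M | M ∈ T.1 ∧ ∀ U : TorsionClass K Λ, U ⋖ T → M ∈ U.1},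
   { iso_closed := fun M N e hM => ⟨T.2.iso_closed M N e hM.1, fun U hU =>
      U.2.iso_closed M N e (hM.2 U hU)⟩
     finDim := fun M hM => T.2.finDim M hM.1
     zero_mem := fun M hM => ⟨T.2.zero_mem M hM, fun U hU => U.2.zero_mem M hM⟩
     quot_closed := fun M N g hg hM => ⟨T.2.quot_closed M N g hg hM.1, fun U hU =>
      U.2.quot_closed M N g hg (hM.2 U hU)⟩
     ext_closed := fun M A hA hQ => ⟨T.2.ext_closed M A hA.1 hQ.1, fun U hU =>
      U.2.ext_closed M A (hA.2 U hU) (hQ.2 U hU)⟩ }⟩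

theorem popD_isPopDown (T : TorsionClass K Λ) : IsPopDown T (popD Λ T) := by
  constructor
  · rintro U (rfl | hU)
    · exact fun M hM => hM.1
    · exact fun M hM => hM.2 U hU
  · intro V hV M hM
    exact ⟨hV (Set.mem_insert _ _) hM, fun U hU => hV (Set.mem_insert_of_mem _ hU) hM⟩

/-- The modules of `T` all of whose submodules lie in `T`. -/
def subCore (T : TorsionClass K Λ) : TorsionClass K Λ :=
  ⟨{M | M ∈ T.1 ∧ ∀ P : Submodule Λᵐᵒᵖ M, ModuleCat.of Λᵐᵒᵖ P ∈ T.1},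
   { iso_closed := fun M N e hM => ⟨T.2.iso_closed M N e hM.1, fun P => by
      have e' := e.submoduleMap (P.comap e.toLinearMap)
      rw [Submodule.map_comap_eq_of_surjective e.surjective] at e'
      exact T.2.quot' Λ e'.toLinearMap e'.surjective (hM.2 _)⟩
     finDim := fun M hM => T.2.finDim M hM.1
     zero_mem := fun M hM => ⟨T.2.zero_mem M hM, fun P =>
      T.2.zero_mem _ (inferInstanceAs (Subsingleton P))⟩
     quot_closed := fun M N g hg hM => ⟨T.2.quot_closed M N g hg hM.1, fun P => by
      let g' : P.comap g →ₗ[Λᵐᵒᵖ] P := g.restrict (fun x hx => hx)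
      have hg' : Function.Surjective g' := by
        rintro ⟨y, hy⟩
        obtain ⟨x, rfl⟩ := hg y
        exact ⟨⟨x, hy⟩, rfl⟩
      exact T.2.quot' Λ g' hg' (hM.2 _)⟩
     ext_closed := fun M A hA hQ => ⟨T.2.ext_closed M A hA.1 hQ.1, fun P => by
      let g : P →ₗ[Λᵐᵒᵖ] (M ⧸ A) := A.mkQ ∘ₗ P.subtype
      refine T.2.ext' Λ g.rangeRestrict g.surjective_rangeRestrict ?_ (hQ.2 _)
      let k : (P.comap A.subtype) →ₗ[Λᵐᵒᵖ] LinearMap.ker g.rangeRestrict :=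
        { toFun := fun x => ⟨⟨x.1.1, x.2⟩, by
            rw [LinearMap.ker_rangeRestrict]
            change A.mkQ x.1.1 = 0
            simp⟩
          map_add' := fun _ _ => rfl
          map_smul' := fun _ _ => rfl }
      have hk : Function.Surjective k := by
        rintro ⟨⟨x, hx⟩, hx'⟩
        rw [LinearMap.ker_rangeRestrict] at hx'
        have hx2 : A.mkQ x = 0 := hx'
        have hxA : x ∈ A := by simpa using hx2
        exact ⟨⟨⟨x, hxA⟩, hx⟩, rfl⟩
      exact T.2.quot' Λ k hk (hA.2 _)⟩ }⟩

/-- Torsion part. -/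
theorem exists_torsion {𝒰 : Set (RMod Λ)} (h : IsTorsionClass K Λ 𝒰) (M : RMod Λ)
    (hM : IsFinDim K Λ M) : ∃ t : Submodule Λᵐᵒᵖ M, ModuleCat.of Λᵐᵒᵖ t ∈ 𝒰 ∧
      ModuleCat.of Λᵐᵒᵖ (M ⧸ t) ∈ Perp Λ 𝒰 := by
  haveI := hM.noeth
  obtain ⟨t, ht, hmax⟩ := set_has_maximal_iff_noetherian.mpr this
    {t : Submodule Λᵐᵒᵖ M | ModuleCat.of Λᵐᵒᵖ t ∈ 𝒰}
    ⟨⊥, h.zero_mem _ (inferInstanceAs (Subsingleton (⊥ : Submodule Λᵐᵒᵖ M)))⟩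
  refine ⟨t, ht, fun X hX f => ?_⟩
  change X →ₗ[Λᵐᵒᵖ] (M ⧸ t) at f
  let P := (LinearMap.range f).comap t.mkQ
  have htP : t ≤ P := fun x hx => by
    change t.mkQ x ∈ LinearMap.range f
    rw [show t.mkQ x = 0 by simpa using hx]
    exact zero_mem _
  have hP : ModuleCat.of Λᵐᵒᵖ P ∈ 𝒰 := by
    let g : P →ₗ[Λᵐᵒᵖ] LinearMap.range f := t.mkQ.restrict (fun x hx => hx)
    refine h.ext' Λ g ?_ ?_ (h.range' Λ f hX)
    · rintro ⟨y, hy⟩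
      obtain ⟨x, rfl⟩ := t.mkQ_surjective y
      exact ⟨⟨x, hy⟩, rfl⟩
    · let k : t →ₗ[Λᵐᵒᵖ] LinearMap.ker g :=
        { toFun := fun x => ⟨⟨x.1, htP x.2⟩, by
            apply Subtype.ext
            change t.mkQ x.1 = 0
            simp⟩
          map_add' := fun _ _ => rfl
          map_smul' := fun _ _ => rfl }
      refine h.quot' Λ k ?_ ht
      rintro ⟨⟨x, hx⟩, hx'⟩
      have h2 : t.mkQ x = 0 := congrArg Subtype.val hx'
      exact ⟨⟨x, by simpa using h2⟩, rfl⟩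
  have hPt : P = t := by
    by_contra hne
    exact hmax P hP (lt_of_le_of_ne htP (Ne.symm hne))
  ext x
  obtain ⟨y, hy⟩ := t.mkQ_surjective (f x)
  have : y ∈ P := by
    change t.mkQ y ∈ LinearMap.range f
    rw [hy]; exact ⟨x, rfl⟩
  rw [hPt] at this
  change f x = 0
  rw [← hy]
  simpa using this

/-- The brick label of a cover relation. -/
theorem exists_label {T U : TorsionClass K Λ} (hUT : U ⋖ T) :
    ∃ B : RMod Λ, B ∈ Perp Λ U.1 ∧ Nontrivial B ∧ B ∈ DSet Λ T.1 ∧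
      ∀ X ∈ T.1, X ∉ U.1 → ∃ f : X →ₗ[Λᵐᵒᵖ] B, Function.Surjective f := by
  -- a nonzero module of minimal length in `T ∩ U^⊥`
  let C : Set (RMod Λ) := {X | X ∈ T.1 ∧ X ∈ Perp Λ U.1 ∧ Nontrivial X}
  have hC : C.Nonempty := by
    obtain ⟨M, hMT, hMU⟩ := Set.exists_of_ssubset (show U.1 ⊂ T.1 from hUT.lt)
    obtain ⟨t, ht, htp⟩ := exists_torsion Λ U.2 M (T.2.finDim M hMT)
    refine ⟨ModuleCat.of Λᵐᵒᵖ (M ⧸ t), T.2.quot' Λ t.mkQ t.mkQ_surjective hMT, htp, ?_⟩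
    by_contra hn
    have hs : Subsingleton (M ⧸ t) := not_nontrivial_iff_subsingleton.mp hn
    exact hMU (U.2.ext_closed M t ht (U.2.zero_mem _ hs))
  obtain ⟨B, ⟨hBT, hBU, hBn⟩, hmin⟩ :=
    exists_minimalFor_of_wellFoundedLT (· ∈ C) (fun X : RMod Λ => Module.length Λᵐᵒᵖ X) hC
  haveI := (T.2.finDim B hBT).noeth
  haveI := (T.2.finDim B hBT).artin
  have hsub : ∀ N : Submodule Λᵐᵒᵖ B, ModuleCat.of Λᵐᵒᵖ N ∈ T.1 → N = ⊥ ∨ N = ⊤ := by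
    intro N hN
    by_contra! hcon
    have hlt := Submodule.length_lt hcon.2
    have hNC : ModuleCat.of Λᵐᵒᵖ N ∈ C := by
      refine ⟨hN, fun X hX f => ?_, Submodule.nontrivial_iff_ne_bot.mpr hcon.1⟩
      change X →ₗ[Λᵐᵒᵖ] N at f
      have := hBU X hX (N.subtype ∘ₗ f)
      ext x
      exact LinearMap.congr_fun this x
    exact absurd (hmin hNC hlt.le) (not_le.mpr hlt)
  have hsurj : ∀ X ∈ T.1, ∀ f : X →ₗ[Λᵐᵒᵖ] B, f ≠ 0 → Function.Surjective f := by
    intro X hX f hf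
    rcases hsub _ (T.2.range' Λ f hX) with h | h
    · exact absurd (LinearMap.range_eq_bot.mp h) hf
    · exact LinearMap.range_eq_top.mp h
  -- every nonzero module in `T ∩ U^⊥` contains `B`
  have hsubB : ∀ X ∈ C, ∃ g : B →ₗ[Λᵐᵒᵖ] X, Function.Injective g := by
    rintro X ⟨hXT, hXU, hXn⟩
    have hex : ∃ g : B →ₗ[Λᵐᵒᵖ] X, g ≠ 0 := by
      by_contra! hcon
      have h1 : U ≤ homKer Λ T X := fun M hM => ⟨hUT.le hM, hXU M hM⟩
      have h2 : homKer Λ T X ≤ T := fun M hM => hM.1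
      have hBV : B ∈ (homKer Λ T X).1 := ⟨hBT, hcon⟩
      rcases hUT.eq_or_eq h1 h2 with h | h
      · rw [h] at hBV
        have h0 := hBU B hBV LinearMap.id
        obtain ⟨b, hb⟩ := exists_ne (0 : B)
        exact hb (LinearMap.congr_fun h0 b)
      · have hXV : X ∈ (homKer Λ T X).1 := by rw [h]; exact hXT
        have h0 := hXV.2 LinearMap.id
        obtain ⟨b, hb⟩ := exists_ne (0 : X)
        exact hb (LinearMap.congr_fun h0 b)
    obtain ⟨g, hg⟩ := hex
    refine ⟨g, ?_⟩
    have hrC : ModuleCat.of Λᵐᵒᵖ (LinearMap.range g) ∈ C := by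
      refine ⟨T.2.range' Λ g hBT, fun Y hY f => ?_, Submodule.nontrivial_iff_ne_bot.mpr
        (fun h => hg (LinearMap.range_eq_bot.mp h))⟩
      change Y →ₗ[Λᵐᵒᵖ] LinearMap.range g at f
      have := hXU Y hY ((LinearMap.range g).subtype ∘ₗ f)
      ext x
      exact LinearMap.congr_fun this x
    have hle : Module.length Λᵐᵒᵖ (LinearMap.range g) ≤ Module.length Λᵐᵒᵖ B :=
      Module.length_le_of_surjective g.rangeRestrict g.surjective_rangeRestrict
    have hge : Module.length Λᵐᵒᵖ B ≤ Module.length Λᵐᵒᵖ (LinearMap.range g) := hmin hrC hle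
    by_contra hni
    have hker : LinearMap.ker g ≠ ⊥ := fun h => hni (LinearMap.ker_eq_bot.mp h)
    have hlt := Submodule.length_quotient_lt (LinearMap.ker g) hker
    rw [g.quotKerEquivRange.length_eq] at hlt
    exact absurd hge (not_le.mpr hlt)
  have hWL : B ∈ WLower Λ T.1 := by
    refine ⟨hBT, fun N hN f => ?_⟩
    by_cases hf0 : f = 0
    · subst hf0
      refine T.2.quot' Λ (M := N) (LinearMap.codRestrict _ LinearMap.id (by simp)) ?_ hN
      rintro ⟨x, hx⟩
      exact ⟨x, rfl⟩
    have hfs := hsurj N hN f hf0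
    -- the torsion part of the kernel
    haveI := (T.2.finDim N hN).noeth
    obtain ⟨t, ht, hle, hperp⟩ : ∃ t : Submodule Λᵐᵒᵖ N, ModuleCat.of Λᵐᵒᵖ t ∈ T.1 ∧
        t ≤ LinearMap.ker f ∧ ∀ s : Submodule Λᵐᵒᵖ N, t ≤ s → s ≤ LinearMap.ker f →
          ModuleCat.of Λᵐᵒᵖ s ∈ T.1 → s = t := by
      obtain ⟨t, ht, hmax⟩ := set_has_maximal_iff_noetherian.mpr this
        {t : Submodule Λᵐᵒᵖ N | ModuleCat.of Λᵐᵒᵖ t ∈ T.1 ∧ t ≤ LinearMap.ker f}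
        ⟨⊥, T.2.zero_mem _ (inferInstanceAs (Subsingleton (⊥ : Submodule Λᵐᵒᵖ N))), bot_le⟩
      refine ⟨t, ht.1, ht.2, fun s hs hsk hsT => ?_⟩
      by_contra hne
      exact hmax s ⟨hsT, hsk⟩ (lt_of_le_of_ne hs (Ne.symm hne))
    -- the quotient
    have hQT : ModuleCat.of Λᵐᵒᵖ (N ⧸ t) ∈ T.1 := T.2.quot' Λ t.mkQ t.mkQ_surjective hN
    let f' : (N ⧸ t) →ₗ[Λᵐᵒᵖ] B := t.liftQ f hle
    have hf' : ∀ x, f' (t.mkQ x) = f x := fun x => rfl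
    have hf's : Function.Surjective f' := fun b => by
      obtain ⟨x, rfl⟩ := hfs b
      exact ⟨t.mkQ x, rfl⟩
    -- any submodule of `ker f'` lying in `T` is zero
    have hkz : ∀ s : Submodule Λᵐᵒᵖ (N ⧸ t), s ≤ LinearMap.ker f' →
        ModuleCat.of Λᵐᵒᵖ s ∈ T.1 → s = ⊥ := by
      intro s hs hsT
      have hts : t ≤ s.comap t.mkQ := fun x hx => by
        change t.mkQ x ∈ s
        rw [show t.mkQ x = 0 by simpa using hx]
        exact zero_mem _
      have h1 : s.comap t.mkQ = t := by
        refine hperp _ hts (fun x hx => ?_) ?_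
        · have : f' (t.mkQ x) = 0 := hs hx
          exact this
        · let g : s.comap t.mkQ →ₗ[Λᵐᵒᵖ] s := t.mkQ.restrict (fun x hx => hx)
          refine T.2.ext' Λ g ?_ ?_ hsT
          · rintro ⟨y, hy⟩
            obtain ⟨x, rfl⟩ := t.mkQ_surjective y
            exact ⟨⟨x, hy⟩, rfl⟩
          · let k : t →ₗ[Λᵐᵒᵖ] LinearMap.ker g :=
              { toFun := fun x => ⟨⟨x.1, hts x.2⟩, by
                  apply Subtype.ext
                  change t.mkQ x.1 = 0
                  simp⟩
                map_add' := fun _ _ => rfl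
                map_smul' := fun _ _ => rfl }
            refine T.2.quot' Λ k ?_ ht
            rintro ⟨⟨x, hx⟩, hx'⟩
            have h2 : t.mkQ x = 0 := congrArg Subtype.val hx'
            exact ⟨⟨x, by simpa using h2⟩, rfl⟩
      rw [eq_bot_iff]
      intro y hy
      obtain ⟨x, rfl⟩ := t.mkQ_surjective y
      have : x ∈ s.comap t.mkQ := hy
      rw [h1] at this
      simpa using this
    have hQC : ModuleCat.of Λᵐᵒᵖ (N ⧸ t) ∈ C := by
      refine ⟨hQT, fun Y hY h => ?_, ?_⟩
      · change Y →ₗ[Λᵐᵒᵖ] (N ⧸ t) at h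
        have h0 := hBU Y hY (f' ∘ₗ h)
        have h1 : LinearMap.range h ≤ LinearMap.ker f' := by
          rintro _ ⟨y, rfl⟩
          exact LinearMap.congr_fun h0 y
        exact LinearMap.range_eq_bot.mp (hkz _ h1 (T.2.range' Λ h (hUT.le hY)))
      · exact hf's.nontrivial
    obtain ⟨g, hg⟩ := hsubB _ hQC
    change B →ₗ[Λᵐᵒᵖ] (N ⧸ t) at g
    have hfg : f' ∘ₗ g ≠ 0 := by
      intro h0
      have h1 : LinearMap.range g ≤ LinearMap.ker f' := by
        rintro _ ⟨y, rfl⟩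
        exact LinearMap.congr_fun h0 y
      have h2 := LinearMap.range_eq_bot.mp (hkz _ h1 (T.2.range' Λ g hBT))
      obtain ⟨b, hb⟩ := exists_ne (0 : B)
      apply hb
      apply hg
      rw [h2]; simp
    have hes := hsurj B hBT (f' ∘ₗ g) hfg
    have hei := IsNoetherian.injective_of_surjective_endomorphism (f' ∘ₗ g) hes
    let e := LinearEquiv.ofBijective (f' ∘ₗ g) ⟨hei, hes⟩
    have he : ∀ b, f' (g (e.symm b)) = b := fun b => e.apply_symm_apply b
    let p : (N ⧸ t) →ₗ[Λᵐᵒᵖ] (N ⧸ t) := LinearMap.id - g ∘ₗ e.symm.toLinearMap ∘ₗ f'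
    have hp : ∀ x, p x = x - g (e.symm (f' x)) := fun x => rfl
    have hpk : LinearMap.range p ≤ LinearMap.ker f' := by
      rintro _ ⟨x, rfl⟩
      rw [LinearMap.mem_ker, hp, map_sub, he, sub_self]
    have hp0 := LinearMap.range_eq_bot.mp (hkz _ hpk (T.2.range' Λ p hQT))
    have hkt : LinearMap.ker f = t := by
      apply le_antisymm _ hle
      intro x hx
      have h1 : p (t.mkQ x) = t.mkQ x := by
        rw [hp, hf', LinearMap.mem_ker.mp hx]; simp
      rw [hp0] at h1
      have h2 : t.mkQ x = 0 := by rw [← h1]; rfl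
      simpa using h2
    rw [hkt]
    exact ht
  refine ⟨B, hBU, hBn, ⟨hWL, exists_ne 0, fun N hN => hsub N hN.1⟩, fun X hX hXU => ?_⟩
  by_contra! hcon
  have hX0 : ∀ f : X →ₗ[Λᵐᵒᵖ] B, f = 0 := fun f => by
    by_contra hf
    exact hcon f (hsurj X hX f hf)
  have h1 : U ≤ homKer Λ T B := fun M hM => ⟨hUT.le hM, hBU M hM⟩
  have h2 : homKer Λ T B ≤ T := fun M hM => hM.1
  rcases hUT.eq_or_eq h1 h2 with h | h
  · exact hXU (by rw [← h]; exact ⟨hX, hX0⟩)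
  · have hBV : B ∈ (homKer Λ T B).1 := by rw [h]; exact hBT
    have h0 := hBV.2 LinearMap.id
    obtain ⟨b, hb⟩ := exists_ne (0 : B)
    exact hb (LinearMap.congr_fun h0 b)

theorem one_three (T : TorsionClass K Λ)
    (h : ∃ T₀ : TorsionClass K Λ, IsPopDown T T₀ ∧ ∀ M : RMod Λ, M ∈ T₀.1 ↔ Subsingleton M) :
    ∀ M ∈ T.1, ∀ N : Submodule Λᵐᵒᵖ M, ModuleCat.of Λᵐᵒᵖ N ∈ T.1 := by
  obtain ⟨T₀, hpop, hz⟩ := h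
  have heq : T₀ = popD Λ T := hpop.unique (popD_isPopDown Λ T)
  subst heq
  have key : ∀ n : ℕ∞, ∀ X : RMod Λ, Module.length Λᵐᵒᵖ X = n → X ∈ T.1 →
      ∀ N : RMod Λ, N ∈ T.1 → ∀ f : N →ₗ[Λᵐᵒᵖ] X,
        ModuleCat.of Λᵐᵒᵖ (LinearMap.ker f) ∈ T.1 := by
    intro n
    induction n using WellFoundedLT.induction with
    | ind n ih =>
      intro X hXn hX N hN f
      by_cases hs : Subsingleton X
      · have hf0 : f = 0 := by ext x; exact Subsingleton.elim _ _
        subst hf0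
        refine T.2.quot' Λ (M := N) (LinearMap.codRestrict _ LinearMap.id (by simp)) ?_ hN
        rintro ⟨x, hx⟩
        exact ⟨x, rfl⟩
      · have hXp : X ∉ (popD Λ T).1 := fun h => hs ((hz X).mp h)
        have : ∃ U : TorsionClass K Λ, U ⋖ T ∧ X ∉ U.1 := by
          by_contra! hcon
          exact hXp ⟨hX, hcon⟩
        obtain ⟨U, hU, hXU⟩ := this
        obtain ⟨B, -, hBn, hBD, hB⟩ := exists_label Λ hU
        obtain ⟨q, hq⟩ := hB X hX hXU
        have hk : ModuleCat.of Λᵐᵒᵖ (LinearMap.ker q) ∈ T.1 := hBD.1.2 X hX q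
        haveI := (T.2.finDim X hX).noeth
        haveI := (T.2.finDim X hX).artin
        have hne : LinearMap.ker q ≠ ⊤ := fun h => by
          rw [LinearMap.ker_eq_top] at h
          subst h
          obtain ⟨b, hb⟩ := exists_ne (0 : B)
          obtain ⟨x, hx⟩ := hq b
          exact hb hx.symm
        have hlt := Submodule.length_lt hne
        have hN1 : ModuleCat.of Λᵐᵒᵖ (LinearMap.ker (q ∘ₗ f)) ∈ T.1 :=
          hBD.1.2 N hN (q ∘ₗ f)
        let f1 : LinearMap.ker (q ∘ₗ f) →ₗ[Λᵐᵒᵖ] LinearMap.ker q :=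
          f.restrict (fun x hx => hx)
        have h3 : ModuleCat.of Λᵐᵒᵖ (LinearMap.ker f1) ∈ T.1 :=
          ih _ (hXn ▸ hlt) (ModuleCat.of Λᵐᵒᵖ (LinearMap.ker q)) rfl hk
            (ModuleCat.of Λᵐᵒᵖ (LinearMap.ker (q ∘ₗ f))) hN1 f1
        let k : LinearMap.ker f1 →ₗ[Λᵐᵒᵖ] LinearMap.ker f :=
          { toFun := fun x => ⟨x.1.1, congrArg Subtype.val x.2⟩
            map_add' := fun _ _ => rfl
            map_smul' := fun _ _ => rfl }
        refine T.2.quot' Λ k ?_ h3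
        rintro ⟨x, hx⟩
        have hx' : f x = 0 := hx
        refine ⟨⟨⟨x, ?_⟩, ?_⟩, rfl⟩
        · change q (f x) = 0
          rw [hx', map_zero]
        · exact Subtype.ext hx'
  intro M hM N
  have := key _ (ModuleCat.of Λᵐᵒᵖ (M ⧸ N)) rfl (T.2.quot' Λ N.mkQ N.mkQ_surjective hM) M hM N.mkQ
  rwa [Submodule.ker_mkQ] at this

theorem three_two (T : TorsionClass K Λ)
    (h : ∀ M ∈ T.1, ∀ N : Submodule Λᵐᵒᵖ M, ModuleCat.of Λᵐᵒᵖ N ∈ T.1) :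
    ∀ M ∈ DSet Λ T.1, IsSimpleModule Λᵐᵒᵖ M := by
  intro M hM
  obtain ⟨⟨hMT, -⟩, ⟨m, hm⟩, hmin⟩ := hM
  haveI : Nontrivial M := ⟨m, 0, hm⟩
  refine isSimpleModule_iff _ _ |>.mpr { eq_bot_or_eq_top := fun N => hmin N ?_ }
  exact ⟨h M hMT N, fun X hX f => h X hX _⟩

theorem two_three (hfin : Finite (TorsionClass K Λ)) (T : TorsionClass K Λ)
    (h : ∀ M ∈ DSet Λ T.1, IsSimpleModule Λᵐᵒᵖ M) :
    ∀ M ∈ T.1, ∀ N : Submodule Λᵐᵒᵖ M, ModuleCat.of Λᵐᵒᵖ N ∈ T.1 := by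
  have hle : subCore Λ T ≤ T := fun M hM => hM.1
  rcases hle.eq_or_lt with heq | hlt
  · intro M hM
    rw [← heq] at hM
    exact hM.2
  · exfalso
    obtain ⟨U, hU1, hU2⟩ := exists_le_covBy_of_lt hlt
    obtain ⟨B, hBU, hBn, hBD, -⟩ := exists_label Λ hU2
    haveI := h B hBD
    have hB : B ∈ (subCore Λ T).1 := by
      refine ⟨hBD.1.1, fun P => ?_⟩
      rcases eq_bot_or_eq_top P with rfl | rfl
      · exact T.2.zero_mem _ (inferInstanceAs (Subsingleton (⊥ : Submodule Λᵐᵒᵖ B)))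
      · exact T.2.quot' Λ (M := B) Submodule.topEquiv.symm.toLinearMap
          Submodule.topEquiv.symm.surjective hBD.1.1
    have h0 := hBU B (hU1 hB) LinearMap.id
    obtain ⟨b, hb⟩ := exists_ne (0 : B)
    exact hb (LinearMap.congr_fun h0 b)

theorem three_one (T : TorsionClass K Λ)
    (h : ∀ M ∈ T.1, ∀ N : Submodule Λᵐᵒᵖ M, ModuleCat.of Λᵐᵒᵖ N ∈ T.1) :
    ∃ T₀ : TorsionClass K Λ, IsPopDown T T₀ ∧ ∀ M : RMod Λ, M ∈ T₀.1 ↔ Subsingleton M := by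
  refine ⟨popD Λ T, popD_isPopDown Λ T, fun X => ⟨fun hX => ?_, (popD Λ T).2.zero_mem X⟩⟩
  by_contra hs
  haveI : Nontrivial X := not_subsingleton_iff_nontrivial.mp hs
  haveI := (T.2.finDim X hX.1).noeth
  obtain ⟨m, hm, -⟩ := (eq_top_or_exists_le_coatom (⊥ : Submodule Λᵐᵒᵖ X)).resolve_left bot_ne_top
  haveI hS : IsSimpleModule Λᵐᵒᵖ (X ⧸ m) := isSimpleModule_iff_isCoatom.mpr hm
  haveI := IsSimpleModule.nontrivial Λᵐᵒᵖ (X ⧸ m)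
  let S : RMod Λ := ModuleCat.of Λᵐᵒᵖ (X ⧸ m)
  haveI : IsSimpleModule Λᵐᵒᵖ S := hS
  haveI : Nontrivial S := ‹Nontrivial (X ⧸ m)›
  have hST : S ∈ T.1 := T.2.quot' Λ m.mkQ m.mkQ_surjective hX.1
  have hle : homKer Λ T S ≤ T := fun M hM => hM.1
  have hSn : S ∉ (homKer Λ T S).1 := fun hc => by
    have h0 := hc.2 LinearMap.id
    obtain ⟨b, hb⟩ := exists_ne (0 : S)
    exact hb (LinearMap.congr_fun h0 b)
  have hlt : homKer Λ T S < T := lt_of_le_of_ne hle (fun he => hSn (by rw [he]; exact hST))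
  have hcov : homKer Λ T S ⋖ T := by
    refine ⟨hlt, fun U hU1 hU2 => ?_⟩
    have hSU : S ∈ U.1 := by
      obtain ⟨M, hMU, hMn⟩ := Set.exists_of_ssubset
        (show (homKer Λ T S).1 ⊂ U.1 from hU1)
      have : ∃ f : M →ₗ[Λᵐᵒᵖ] S, f ≠ 0 := by
        by_contra! hcon
        exact hMn ⟨hU2.le hMU, hcon⟩
      obtain ⟨f, hf⟩ := this
      exact U.2.quot_closed M S f (LinearMap.surjective_of_ne_zero hf) hMU
    have key : ∀ n : ℕ∞, ∀ M : RMod Λ, Module.length Λᵐᵒᵖ M = n → M ∈ T.1 → M ∈ U.1 := by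
      intro n
      induction n using WellFoundedLT.induction with
      | ind n ih =>
        intro M hMn hM
        by_cases hf : ∃ f : M →ₗ[Λᵐᵒᵖ] S, f ≠ 0
        · obtain ⟨f, hf⟩ := hf
          haveI := (T.2.finDim M hM).noeth
          haveI := (T.2.finDim M hM).artin
          have hlt := Submodule.length_lt (fun hc => hf (LinearMap.ker_eq_top.mp hc))
          have hk := ih _ (hMn ▸ hlt) (ModuleCat.of Λᵐᵒᵖ (LinearMap.ker f)) rfl (h M hM _)
          exact U.2.ext' Λ f (LinearMap.surjective_of_ne_zero hf) hk hSU
        · push Not at hf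
          exact hU1.le ⟨hM, hf⟩
    exact hU2.not_ge (fun M hM => key _ M rfl hM)
  have h0 := (hX.2 _ hcov).2 m.mkQ
  obtain ⟨b, hb⟩ := exists_ne (0 : X ⧸ m)
  obtain ⟨x, rfl⟩ := m.mkQ_surjective b
  exact hb (LinearMap.congr_fun h0 x)

/-- Let `Λ` be a τ-tilting finite finite-dimensional `K`-algebra and `𝒯` a
torsion class.  The following are equivalent: (1) `pop↓(𝒯)` is the zero torsion class (the
class of modules with only the zero element); (2) every module in `𝒟(𝒯)` is simple; (3) `𝒯`
is closed under submodules (i.e. is a Serre subcategory). -/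
theorem stmt5 [FiniteDimensional K Λ] (hfin : Finite (TorsionClass K Λ))
    (T : TorsionClass K Λ) :
    ((∃ T₀ : TorsionClass K Λ, IsPopDown T T₀ ∧ ∀ M : RMod Λ, M ∈ T₀.1 ↔ Subsingleton M) ↔
      ∀ M ∈ DSet Λ T.1, IsSimpleModule Λᵐᵒᵖ M) ∧
    ((∃ T₀ : TorsionClass K Λ, IsPopDown T T₀ ∧ ∀ M : RMod Λ, M ∈ T₀.1 ↔ Subsingleton M) ↔
      ∀ M ∈ T.1, ∀ N : Submodule Λᵐᵒᵖ M, ModuleCat.of Λᵐᵒᵖ N ∈ T.1) := by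
  exact ⟨⟨fun h => three_two Λ T (one_three Λ T h),
    fun h => three_one Λ T (two_three Λ hfin T h)⟩,
    ⟨one_three Λ T, three_one Λ T⟩⟩

end PaperTors
end

section
/- Let K be a field, Λ a τ-tilting finite finite-dimensional K-algebra, and 𝒯 a torsion class of finite-dimensional right Λ-modules. The following are equivalent: (1) there exists a projective Λ-module P such that 𝒯 = Gen(P), where Gen(P) = {M : there exist r ∈ ℕ and a surjective Λ-module homomorphism P^r ↠ M}; (2) there exists a set 𝒮 of simple Λ-modules such that every module in 𝒮 belongs to 𝒯, every simple Λ-module belonging to 𝒯 is isomorphic to a member of 𝒮, and every torsion class 𝒯′ satisfying these two conditions (with the same 𝒮) is contained in 𝒯 — that is, 𝒯 is the largest torsion class that contains all modules in 𝒮 and contains no simple module not in 𝒮. -/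
namespace PaperTors

universe u

variable (K : Type u) [Field K] (Λ : Type u) [Ring Λ] [Algebra K Λ]

variable {K}

theorem aux_exists_idem {R : Type u} [Ring R] [IsArtinianRing R] (p : ModuleCat.{u} R → Prop)
    (hp : ∀ M N : ModuleCat.{u} R, (M ≃ₗ[R] N) → p M → p N) :
    ∃ e : R, IsIdempotentElem e ∧
      ∀ S : ModuleCat.{u} R, IsSimpleModule R S → (p S ↔ ∃ y : S, e • y ≠ 0) := by
  let J := Ring.jacobson R
  have hss : IsSemisimpleModule R (R ⧸ J) := by
    have h0 : IsSemisimpleRing (R ⧸ J) := IsSemiprimaryRing.isSemisimpleRing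
    let l : (R ⧸ J) →ₛₗ[Ideal.Quotient.mk J] (R ⧸ J) :=
      { toFun := id
        map_add' := fun _ _ => rfl
        map_smul' := by
          intro r x
          obtain ⟨x, rfl⟩ := Ideal.Quotient.mk_surjective x
          rfl }
    have : RingHomSurjective (Ideal.Quotient.mk J) := ⟨Ideal.Quotient.mk_surjective⟩
    exact (LinearMap.isSemisimpleModule_iff_of_bijective l Function.bijective_id).2 h0
  let I : Submodule R (R ⧸ J) :=
    sSup {L | IsSimpleModule R L ∧ p (ModuleCat.of R L)}
  obtain ⟨I', hI⟩ := exists_isCompl I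
  obtain ⟨q, hq⟩ := IsSemisimpleModule.extension_property I.subtype I.injective_subtype
    (LinearMap.id : I →ₗ[R] I)
  have hq' : ∀ x : R ⧸ J, x ∈ I → (q x : R ⧸ J) = x := by
    intro x hx
    have := LinearMap.congr_fun hq ⟨x, hx⟩
    simpa using congrArg Subtype.val this
  have hone : ∀ a : R, a • (1 : R ⧸ J) = Ideal.Quotient.mk J a := by
    intro a
    change Ideal.Quotient.mk J (a * 1) = _
    rw [mul_one]
  obtain ⟨c, hc⟩ := Ideal.Quotient.mk_surjective (q 1 : R ⧸ J)
  have hqmk : ∀ a : R, (q (Ideal.Quotient.mk J a) : R ⧸ J) = Ideal.Quotient.mk J (a * c) := by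
    intro a
    rw [← hone, map_smul, Submodule.coe_smul, ← hc]
    rfl
  have hidem : IsIdempotentElem (q 1 : R ⧸ J) := by
    have h1 := hq' (q 1 : R ⧸ J) (q 1).2
    rw [← hc, hqmk, map_mul] at h1
    rw [← hc]
    exact h1
  obtain ⟨n, hn⟩ : IsNilpotent J := IsSemiprimaryRing.isNilpotent
  obtain ⟨e, he, hee⟩ := exists_isIdempotentElem_eq_of_ker_isNilpotent (Ideal.Quotient.mk J)
    (by
      intro x hx
      rw [Ideal.mk_ker] at hx
      refine ⟨n, ?_⟩
      have := Ideal.pow_mem_pow hx n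
      rw [hn] at this
      simpa using this) (q 1 : R ⧸ J) ⟨c, hc⟩ hidem
  have hqmk : ∀ a : R, (q (Ideal.Quotient.mk J a) : R ⧸ J) = Ideal.Quotient.mk J (a * e) := by
    intro a
    rw [hqmk, map_mul, map_mul, hc, hee]
  refine ⟨e, he, fun S hS => ?_⟩
  have hJ : ∀ y : S, J ≤ LinearMap.ker (LinearMap.toSpanSingleton R S y) := by
    intro y a ha
    have := IsSemisimpleModule.jacobson_le_annihilator R S ha
    rw [Module.mem_annihilator] at this
    simpa using this y
  let h : S → ((R ⧸ J) →ₗ[R] S) := fun y => Submodule.liftQ J _ (hJ y)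
  have hh : ∀ y a, h y (Ideal.Quotient.mk J a) = a • y := fun y a => by
    change Submodule.liftQ J _ (hJ y) (Submodule.Quotient.mk a) = _
    rw [Submodule.liftQ_apply, LinearMap.toSpanSingleton_apply]
  constructor
  · intro hpS
    by_contra! hcon
    have := IsSimpleModule.nontrivial R S
    obtain ⟨y, hy⟩ := exists_ne (0 : S)
    have hne : h y ≠ 0 := by
      intro h0
      apply hy
      have := hh y 1
      rw [h0, one_smul] at this
      simpa using this.symm
    obtain ⟨s, hs⟩ := IsSemisimpleModule.lifting_property (h y)
      (LinearMap.surjective_of_ne_zero hne) (LinearMap.id : S →ₗ[R] S)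
    have hs' : ∀ x, h y (s x) = x := fun x => LinearMap.congr_fun hs x
    have hinj : Function.Injective s := Function.LeftInverse.injective hs'
    let eqv := LinearEquiv.ofInjective s hinj
    have hle : LinearMap.range s ≤ I := by
      apply le_sSup
      exact ⟨IsSimpleModule.congr eqv.symm, hp S (ModuleCat.of R (LinearMap.range s)) eqv hpS⟩
    apply hy
    obtain ⟨d, hd⟩ := Ideal.Quotient.mk_surjective (s y)
    have h2 := hq' (s y) (hle ⟨y, rfl⟩)
    rw [← hs' y, ← h2, ← hd, hqmk, hh, mul_smul, hcon, smul_zero]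
  · rintro ⟨y, hy⟩
    have hnle : ¬ I ≤ LinearMap.ker (h y) := by
      intro hle
      have := hle (q 1).2
      rw [LinearMap.mem_ker, ← hee, hh] at this
      exact hy this
    have : ∃ L : Submodule R (R ⧸ J), (IsSimpleModule R L ∧ p (ModuleCat.of R L)) ∧
        ¬ L ≤ LinearMap.ker (h y) := by
      by_contra! hcon
      exact hnle (sSup_le hcon)
    obtain ⟨L, ⟨hL, hpL⟩, hLk⟩ := this
    have hne : (h y) ∘ₗ L.subtype ≠ 0 := by
      intro h0
      apply hLk
      intro x hx
      exact LinearMap.congr_fun h0 ⟨x, hx⟩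
    have hbij := (LinearMap.bijective_or_eq_zero ((h y) ∘ₗ L.subtype)).resolve_right hne
    exact hp (ModuleCat.of R L) S (LinearEquiv.ofBijective _ hbij) hpL

theorem aux_gen {R : Type u} [Ring R] (P M : Type u) [AddCommGroup P] [Module R P]
    [AddCommGroup M] [Module R M] [Module.Projective R P] [Module.Finite R M]
    (H : ∀ N : Submodule R M, IsSimpleModule R (M ⧸ N) → ∃ g : P →ₗ[R] (M ⧸ N), g ≠ 0) :
    ∃ (r : ℕ) (f : (Fin r → P) →ₗ[R] M), Function.Surjective f := by
  let s : Set M := {m | ∃ (g : P →ₗ[R] M) (x : P), g x = m}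
  have hs : Submodule.span R s = ⊤ := by
    by_contra hne
    obtain ⟨N, hN, hle⟩ := (eq_top_or_exists_le_coatom (Submodule.span R s)).resolve_left hne
    obtain ⟨g, hg⟩ := H N (isSimpleModule_iff_isCoatom.2 hN)
    obtain ⟨g', hg'⟩ := Module.projective_lifting_property N.mkQ g N.mkQ_surjective
    apply hg
    ext x
    rw [← hg']
    simp only [LinearMap.comp_apply, Submodule.mkQ_apply, LinearMap.zero_apply]
    rw [Submodule.Quotient.mk_eq_zero]
    exact hle (Submodule.subset_span ⟨g', x, rfl⟩)
  have hfg : (Submodule.span R s).FG := hs ▸ Module.Finite.fg_top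
  obtain ⟨t, hts, ht⟩ := (Submodule.fg_span_iff_fg_span_finset_subset s).1 hfg
  have hc : ∀ i : Fin t.card, ∃ (g : P →ₗ[R] M) (x : P), g x = t.equivFin.symm i :=
    fun i => hts (t.equivFin.symm i).2
  choose g x hgx using hc
  refine ⟨t.card, LinearMap.lsum R (fun _ => P) ℕ g, ?_⟩
  rw [← LinearMap.range_eq_top, eq_top_iff, ← hs, ht, Submodule.span_le]
  intro m hm
  refine ⟨Pi.single (t.equivFin ⟨m, hm⟩) (x (t.equivFin ⟨m, hm⟩)), ?_⟩
  rw [LinearMap.lsum_piSingle, hgx]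
  simp

theorem aux_component {R : Type u} [Ring R] {P S : Type u} [AddCommGroup P] [Module R P]
    [AddCommGroup S] [Module R S] [IsSimpleModule R S] {r : ℕ}
    (f : (Fin r → P) →ₗ[R] S) (hf : Function.Surjective f) : ∃ g : P →ₗ[R] S, g ≠ 0 := by
  by_contra! hcon
  have : f = 0 := LinearMap.pi_ext' fun i => hcon _
  have := IsSimpleModule.nontrivial R S
  obtain ⟨y, hy⟩ := exists_ne (0 : S)
  obtain ⟨x, rfl⟩ := hf y
  simp_all

theorem aux_finDim [FiniteDimensional K Λ] (M : RMod Λ) :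
    IsFinDim K Λ M ↔ Module.Finite Λᵐᵒᵖ M := by
  letI : Module K M := Module.compHom M (algebraMap K Λᵐᵒᵖ)
  have : IsScalarTower K Λᵐᵒᵖ M := ⟨fun k a m => by
    rw [Algebra.smul_def, mul_smul]; rfl⟩
  have : Module.Finite K Λᵐᵒᵖ := Module.Finite.equiv (MulOpposite.opLinearEquiv K)
  exact ⟨fun (h : Module.Finite K M) => Module.Finite.of_restrictScalars_finite K Λᵐᵒᵖ M,
    fun h => (Module.Finite.trans Λᵐᵒᵖ M : Module.Finite K M)⟩

/-- The modules all of whose simple quotients lie in `T` form a torsion class. -/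
theorem aux_torsion [FiniteDimensional K Λ] (T : TorsionClass K Λ) :
    IsTorsionClass K Λ {M | Module.Finite Λᵐᵒᵖ M ∧ ∀ S : RMod Λ, IsSimpleModule Λᵐᵒᵖ S →
      ∀ f : M →ₗ[Λᵐᵒᵖ] S, Function.Surjective f → S ∈ T.1} where
  iso_closed := by
    rintro M N e ⟨h1, h2⟩
    exact ⟨Module.Finite.equiv e, fun S hS f hf =>
      h2 S hS (f ∘ₗ e.toLinearMap) (hf.comp e.surjective)⟩
  finDim := fun M h => (aux_finDim Λ M).2 h.1
  zero_mem := by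
    intro M hM
    refine ⟨inferInstance, fun S hS f hf => ?_⟩
    have := IsSimpleModule.nontrivial Λᵐᵒᵖ S
    have := hf.subsingleton
    exact (not_subsingleton S this).elim
  quot_closed := by
    rintro M N e he ⟨h1, h2⟩
    exact ⟨Module.Finite.of_surjective e he, fun S hS f hf => h2 S hS (f ∘ₗ e) (hf.comp he)⟩
  ext_closed := by
    rintro M A ⟨h1, h2⟩ ⟨h3, h4⟩
    have h1' : Module.Finite Λᵐᵒᵖ A := h1
    have h3' : Module.Finite Λᵐᵒᵖ (M ⧸ A) := h3
    refine ⟨Module.Finite.of_submodule_quotient A, fun S hS f hf => ?_⟩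
    rcases LinearMap.surjective_or_eq_zero (f ∘ₗ A.subtype) with h | h
    · exact h2 S hS (f ∘ₗ A.subtype) h
    · have hle : A ≤ LinearMap.ker f := fun x hx => LinearMap.congr_fun h ⟨x, hx⟩
      refine h4 S hS (A.liftQ f hle) ?_
      intro y
      obtain ⟨x, rfl⟩ := hf y
      exact ⟨Submodule.Quotient.mk x, Submodule.liftQ_apply _ _ _⟩

/-- Let `Λ` be a τ-tilting finite finite-dimensional `K`-algebra and `𝒯` a
torsion class.  The following are equivalent: (1) `𝒯 = Gen(P)` for some projective module `P`,
where `Gen(P)` consists of the quotients of finite direct powers of `P`; (2) there is a set `𝒮`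
of simple modules such that `𝒯` is the largest torsion class containing all modules of `𝒮` and
containing no simple module not isomorphic to a member of `𝒮`. -/
theorem stmt6 [FiniteDimensional K Λ] (hfin : Finite (TorsionClass K Λ))
    (T : TorsionClass K Λ) :
    (∃ P : RMod Λ, Module.Projective Λᵐᵒᵖ P ∧
      ∀ M : RMod Λ, M ∈ T.1 ↔
        ∃ (r : ℕ) (f : (Fin r → P) →ₗ[Λᵐᵒᵖ] M), Function.Surjective f) ↔
    (∃ 𝒮 : Set (RMod Λ),
      (∀ S ∈ 𝒮, IsSimpleModule Λᵐᵒᵖ S) ∧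
      (∀ S ∈ 𝒮, S ∈ T.1) ∧
      (∀ S : RMod Λ, IsSimpleModule Λᵐᵒᵖ S → S ∈ T.1 →
        ∃ S' ∈ 𝒮, Nonempty (S ≃ₗ[Λᵐᵒᵖ] S')) ∧
      (∀ T' : TorsionClass K Λ,
        (∀ S ∈ 𝒮, S ∈ T'.1) →
        (∀ S : RMod Λ, IsSimpleModule Λᵐᵒᵖ S → S ∈ T'.1 →
          ∃ S' ∈ 𝒮, Nonempty (S ≃ₗ[Λᵐᵒᵖ] S')) →
        T' ≤ T)) := by
  have : Module.Finite K Λᵐᵒᵖ := Module.Finite.equiv (MulOpposite.opLinearEquiv K)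
  have : IsArtinianRing Λᵐᵒᵖ := IsArtinianRing.of_finite K Λᵐᵒᵖ
  constructor
  · rintro ⟨P, hP, hT⟩
    refine ⟨{S | IsSimpleModule Λᵐᵒᵖ S ∧ S ∈ T.1}, fun S h => h.1, fun S h => h.2,
      fun S h1 h2 => ⟨S, ⟨h1, h2⟩, ⟨LinearEquiv.refl _ _⟩⟩, ?_⟩
    intro T' _ h2 M hM
    have : Module.Finite Λᵐᵒᵖ M := (aux_finDim Λ M).1 (T'.2.finDim M hM)
    refine (hT M).2 (aux_gen P M fun N hN => ?_)
    obtain ⟨S', ⟨hS', hS'T⟩, ⟨e⟩⟩ := h2 (ModuleCat.of Λᵐᵒᵖ (M ⧸ N)) hN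
      (T'.2.quot_closed M _ N.mkQ N.mkQ_surjective hM)
    obtain ⟨r, f, hf⟩ := (hT _).1 (T.2.iso_closed _ _ e.symm hS'T)
    exact aux_component f hf
  · rintro ⟨𝒮, h1, h2, h3, h4⟩
    have hle := h4 ⟨_, aux_torsion Λ T⟩
      (fun S hS => ⟨(aux_finDim Λ S).1 (T.2.finDim S (h2 S hS)),
        fun S' _ f hf => T.2.quot_closed S S' f hf (h2 S hS)⟩)
      (fun S hS hST => h3 S hS (hST.2 S hS LinearMap.id Function.surjective_id))
    obtain ⟨e, he, hes⟩ := aux_exists_idem (R := Λᵐᵒᵖ) (fun M => M ∈ T.1) T.2.iso_closed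
    let P : Submodule Λᵐᵒᵖ Λᵐᵒᵖ := LinearMap.range (LinearMap.toSpanSingleton Λᵐᵒᵖ Λᵐᵒᵖ e)
    have hPe : ∀ x ∈ P, x * e = x := by
      rintro _ ⟨a, rfl⟩
      simp only [LinearMap.toSpanSingleton_apply, smul_eq_mul]
      rw [mul_assoc, he.eq]
    have heP : e ∈ P := ⟨1, by simp⟩
    have hproj : Module.Projective Λᵐᵒᵖ P := by
      refine Module.Projective.of_split P.subtype
        (LinearMap.toSpanSingleton Λᵐᵒᵖ Λᵐᵒᵖ e).rangeRestrict ?_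
      ext x
      simpa using hPe x x.2
    refine ⟨ModuleCat.of Λᵐᵒᵖ P, hproj, fun M => ⟨fun hM => ?_, ?_⟩⟩
    · have : Module.Finite Λᵐᵒᵖ M := (aux_finDim Λ M).1 (T.2.finDim M hM)
      refine aux_gen P M fun N hN => ?_
      obtain ⟨y, hy⟩ := (hes (ModuleCat.of Λᵐᵒᵖ (M ⧸ N)) hN).1
        (T.2.quot_closed M _ N.mkQ N.mkQ_surjective hM)
      refine ⟨(LinearMap.toSpanSingleton Λᵐᵒᵖ (M ⧸ N) y) ∘ₗ P.subtype, fun h0 => hy ?_⟩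
      exact LinearMap.congr_fun h0 ⟨e, heP⟩
    · rintro ⟨r, f, hf⟩
      apply hle
      have : Module.Finite Λᵐᵒᵖ P := Module.Finite.range _
      refine ⟨Module.Finite.of_surjective (M := Fin r → P) f hf, fun S hS g hg => ?_⟩
      obtain ⟨k, hk⟩ := aux_component (P := P) (g ∘ₗ f) (hg.comp hf)
      refine (hes S hS).2 ⟨k ⟨e, heP⟩, fun h0 => hk ?_⟩
      have h5 : ∀ x : P, k x = (x : Λᵐᵒᵖ) • k ⟨e, heP⟩ := by
        intro x
        rw [← map_smul]
        congr 1
        exact Subtype.ext (hPe x x.2).symm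
      have h6 : k ⟨e, heP⟩ = 0 := by
        have := h5 ⟨e, heP⟩
        rw [this]
        exact h0
      ext x
      rw [h5, h6, smul_zero]
      rfl

end PaperTors
end

section
/- Let L be a finite lattice, let x ∈ L, and let pop↓(x) denote the meet of the set {x} ∪ {y ∈ L : y ⋖ x}. If the interval [pop↓(x), x] of L, with the induced order, is a distributive lattice, then it is a Boolean lattice, i.e., order-isomorphic to the lattice of all subsets of some finite set ordered by inclusion. -/
/-- A poset (under its induced order) "is a distributive lattice": all pairwise greatest lower
bounds and least upper bounds exist, and the distributive law holds. -/
def IsDistribLatticeOrder (α : Type*) [Preorder α] : Prop :=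
  ∃ inf sup : α → α → α,
    (∀ a b : α, IsGLB {a, b} (inf a b)) ∧ (∀ a b : α, IsLUB {a, b} (sup a b)) ∧
    ∀ a b c : α, inf a (sup b c) = sup (inf a b) (inf a c)

/-- A poset (under its induced order) "is a Boolean lattice": it is order-isomorphic to the
lattice of all subsets of some finite set, ordered by inclusion. -/
def IsBooleanOrder (α : Type*) [Preorder α] : Prop :=
  ∃ (γ : Type) (_ : Fintype γ), Nonempty (α ≃o Set γ)

theorem aux_compl {α : Type*} [DistribLattice α] [BoundedOrder α] [Finite α]
    (h : ∀ a : α, (∀ c, IsCoatom c → a ≤ c) → a = ⊥) : ComplementedLattice α := by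
  classical
  haveI := Fintype.ofFinite α
  refine ⟨fun a => ⟨(Finset.univ.filter fun c => IsCoatom c ∧ ¬ a ≤ c).inf id, ?_, ?_⟩⟩
  · rw [disjoint_iff]
    apply h
    intro c hc
    by_cases hac : a ≤ c
    · exact inf_le_left.trans hac
    · exact inf_le_right.trans (Finset.inf_le (f := id) (by simp [hc, hac]))
  · rw [codisjoint_iff]
    rcases eq_top_or_exists_le_coatom
      (a ⊔ (Finset.univ.filter fun c => IsCoatom c ∧ ¬ a ≤ c).inf id) with h1 | ⟨c, hc, hle⟩
    · exact h1
    · exfalso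
      have hac : a ≤ c := le_sup_left.trans hle
      have hb := le_sup_right.trans hle
      have key : ∀ s : Finset α, (∀ d ∈ s, IsCoatom d ∧ ¬ a ≤ d) → ¬ s.inf id ≤ c := by
        intro s
        induction s using Finset.induction_on with
        | empty => intro _ h2; exact hc.1 (top_le_iff.1 (by simpa using h2))
        | insert d s hd ih =>
          intro hs h2
          have hd1 := hs d (by simp)
          have ih1 := ih (fun e he => hs e (by simp [he]))
          rw [Finset.inf_insert, id] at h2
          have h3 : d ⊔ c = ⊤ := by
            apply hd1.1.2
            refine lt_of_le_of_ne le_sup_left ?_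
            intro heq
            have hcd : c ≤ d := by rw [heq]; exact le_sup_right
            exact hd1.2 (hac.trans hcd)
          have h4 : s.inf id ≤ c := by
            calc s.inf id = s.inf id ⊓ (d ⊔ c) := by rw [h3, inf_top_eq]
              _ = (s.inf id ⊓ d) ⊔ (s.inf id ⊓ c) := inf_sup_left _ _ _
              _ ≤ c := sup_le (by rwa [inf_comm]) inf_le_right
          exact ih1 h4
      exact key _ (by simp) hb

theorem aux_bool {α : Type*} [DistribLattice α] [BoundedOrder α] [Finite α]
    (h : ∀ a : α, (∀ c, IsCoatom c → a ≤ c) → a = ⊥) : IsBooleanOrder α := by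
  classical
  haveI := aux_compl h
  haveI := Fintype.ofFinite α
  letI : BooleanAlgebra α := DistribLattice.booleanAlgebraOfComplemented α
  letI : CompleteAtomicBooleanAlgebra α := Fintype.toCompleteAtomicBooleanAlgebra α
  let e1 : α ≃o Set {a : α // IsAtom a} := CompleteAtomicBooleanAlgebra.toSetOfIsAtom
  let e2 := Finite.equivFin {a : α // IsAtom a}
  refine ⟨Fin _, inferInstance, ⟨e1.trans ⟨Equiv.Set.congr e2, ?_⟩⟩⟩
  intro a b
  exact Set.image_subset_image_iff e2.injective

theorem aux_dist {α : Type*} [P : PartialOrder α] [B : BoundedOrder α] [Finite α]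
    (hd : IsDistribLatticeOrder α)
    (h : ∀ a : α, (∀ c, IsCoatom c → a ≤ c) → a = ⊥) : IsBooleanOrder α := by
  obtain ⟨inf, sup, hi, hs, hdis⟩ := hd
  letI LL : Lattice α :=
    { P with
      inf := inf
      sup := sup
      inf_le_left := fun a b => (hi a b).1 (by simp)
      inf_le_right := fun a b => (hi a b).1 (by simp)
      le_inf := fun a b c hab hac => (hi b c).2 (by simp [mem_lowerBounds, hab, hac])
      le_sup_left := fun a b => (hs a b).1 (by simp)
      le_sup_right := fun a b => (hs a b).1 (by simp)
      sup_le := fun a b c hab hac => (hs a b).2 (by simp [mem_upperBounds, hab, hac]) }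
  letI : DistribLattice α := DistribLattice.ofInfSupLe (fun a b c => (hdis a b c).le)
  exact aux_bool h

/-- Let `L` be a finite lattice, `x ∈ L`, and let `p = pop↓(x)` be the meet of
`{x} ∪ {y : y ⋖ x}` (equivalently, the greatest lower bound of that set).  If the interval
`[p, x]`, with the induced order, is a distributive lattice, then it is a Boolean lattice. -/
theorem stmt14 {L : Type*} [Lattice L] [Finite L] (x p : L)
    (hp : IsGLB (insert x {y | y ⋖ x}) p)
    (hdist : IsDistribLatticeOrder ↥(Set.Icc p x)) :
    IsBooleanOrder ↥(Set.Icc p x) := by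
  have hpx : p ≤ x := hp.1 (by simp)
  haveI : Fact (p ≤ x) := ⟨hpx⟩
  refine aux_dist hdist ?_
  intro a ha
  refine le_antisymm ?_ bot_le
  change (a : L) ≤ p
  refine hp.2 ?_
  rintro y (rfl | hy)
  · exact a.2.2
  · have hy' : y ⋖ x := hy
    have hpy : p ≤ y := hp.1 (Or.inr hy)
    refine ha ⟨y, hpy, hy'.le⟩ ⟨?_, ?_⟩
    · intro h
      exact hy'.lt.ne (congrArg Subtype.val h)
    · rintro ⟨b, hb⟩ hlt
      apply Subtype.ext
      change b = x
      have hlt' : y < b := hlt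
      by_contra hne
      exact hy'.2 hlt' (lt_of_le_of_ne hb.2 hne)
end

section
/- Let L be a finite semidistributive lattice, i.e., a finite lattice such that for all x, y, z ∈ L: x ∧ y = x ∧ z implies x ∧ y = x ∧ (y ∨ z), and x ∨ y = x ∨ z implies x ∨ y = x ∨ (y ∧ z). If L has exactly k coatoms (elements covered by the maximum element of L), then the cardinality of L is at least 2^k. -/
/-- Let `L` be a finite semidistributive lattice (for all `x y z`,
`x ⊓ y = x ⊓ z → x ⊓ y = x ⊓ (y ⊔ z)` and `x ⊔ y = x ⊔ z → x ⊔ y = x ⊔ (y ⊓ z)`), with maximum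
element `t`.  If `L` has exactly `k` coatoms (elements covered by the maximum element), then
`L` has at least `2 ^ k` elements. -/
theorem stmt15 {L : Type*} [Lattice L] [Fintype L]
    (hSD_inf : ∀ x y z : L, x ⊓ y = x ⊓ z → x ⊓ y = x ⊓ (y ⊔ z))
    (hSD_sup : ∀ x y z : L, x ⊔ y = x ⊔ z → x ⊔ y = x ⊔ (y ⊓ z))
    (t : L) (ht : ∀ y : L, y ≤ t)
    (k : ℕ) (hk : {y : L | y ⋖ t}.ncard = k) :
    2 ^ k ≤ Fintype.card L := by
  classical
  letI : OrderTop L := { top := t, le_top := ht }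
  let C : Finset L := Finset.univ.filter (fun y => y ⋖ t)
  have hC : C.card = k := by
    rw [← hk, ← Set.ncard_coe_finset]
    congr 1
    ext y
    simp [C]
  have key : ∀ c : L, c ⋖ t → ∀ S : Finset L, (∀ s ∈ S, s ⋖ t) → c ∉ S → c ⊔ S.inf id = t := by
    intro c hc S
    induction S using Finset.induction_on with
    | empty =>
      intro _ _
      rw [Finset.inf_empty]
      exact le_antisymm (ht _) le_sup_right
    | insert a S ha ih =>
      intro hS hcS
      have h1 := ih (fun s hs => hS s (Finset.mem_insert_of_mem hs))
        (fun h => hcS (Finset.mem_insert_of_mem h))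
      have hat : a ⋖ t := hS a (Finset.mem_insert_self _ _)
      have hne : c ≠ a := fun h => hcS (h ▸ Finset.mem_insert_self _ _)
      have h2 : c ⊔ a = t := by
        rcases hc.eq_or_eq (c := c ⊔ a) le_sup_left (ht _) with h | h
        · have hac : a ≤ c := sup_eq_left.mp h
          rcases hat.eq_or_eq hac (ht _) with h' | h'
          · exact absurd h' hne
          · exact absurd h' hc.lt.ne
        · exact h
      rw [Finset.inf_insert, id, ← hSD_sup c a (S.inf id) (h2.trans h1.symm), h2]
  have sub : ∀ S ∈ C.powerset, ∀ T ∈ C.powerset, S.inf id = T.inf id → S ⊆ T := by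
    intro S hS T hT h c hcS
    by_contra hcT
    have hct : c ⋖ t := by simpa [C] using Finset.mem_powerset.mp hS hcS
    have h1 := key c hct T
      (fun s hs => by simpa [C] using Finset.mem_powerset.mp hT hs) hcT
    have h2 : S.inf id ≤ c := Finset.inf_le (f := id) hcS
    rw [← h, sup_eq_left.mpr h2] at h1
    exact hct.lt.ne h1
  rw [← hC, ← Finset.card_powerset, ← Finset.card_univ]
  apply Finset.card_le_card_of_injOn (fun S => S.inf id) (fun _ _ => by simp)
  intro S hS T hT h
  exact Finset.Subset.antisymm (sub S hS T hT h) (sub T hT S hS h.symm)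
end

section
/- Let L be a finite lattice and ≡ a lattice congruence on L, with π↓ : L → L the map sending each element to the least element of its ≡-equivalence class. If x ∈ L satisfies x = π↓(x), then π↓ restricts to a bijection from the set {a ∈ L : a ⋖ x in L} of elements covered by x in L onto the set of elements covered by x in the subposet π↓(L) (the image of π↓ with the order induced from L). -/
/-- Let `L` be a finite lattice and `r` a lattice congruence on `L` (an
equivalence relation compatible with meets and joins), and let `π : L → L` send each element to
the least element of its congruence class.  If `x ∈ L` satisfies `π x = x`, then `π` restricts to
a bijection from the set of elements covered by `x` in `L` onto the set of elements covered by
`x` in the subposet `π(L)` (the image of `π` with the order induced from `L`). -/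
theorem stmt16 {L : Type*} [Lattice L] [Finite L]
    (r : L → L → Prop) (hequiv : Equivalence r)
    (hinf : ∀ x y z : L, r x y → r (x ⊓ z) (y ⊓ z))
    (hsup : ∀ x y z : L, r x y → r (x ⊔ z) (y ⊔ z))
    (π : L → L) (hπ : ∀ x : L, IsLeast {y | r y x} (π x))
    (x : L) (hx : π x = x) :
    Set.BijOn (fun a => (⟨π a, ⟨a, rfl⟩⟩ : ↥(Set.range π)))
      {a : L | a ⋖ x}
      {b : ↥(Set.range π) | b ⋖ (⟨x, ⟨x, hx⟩⟩ : ↥(Set.range π))} := by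
  have hr : ∀ a, r (π a) a := fun a => (hπ a).1
  have hle : ∀ a, π a ≤ a := fun a => (hπ a).2 (hequiv.refl a)
  have hmin : ∀ a y, r y a → π a ≤ y := fun a y h => (hπ a).2 h
  have hxmin : ∀ y, r y x → x ≤ y := fun y h => hx ▸ hmin x y h
  have hjoin : ∀ a c, a ⋖ x → c ≤ x → ¬ c ≤ a → a ⊔ c = x := by
    intro a c ha hc hca
    rcases ha.eq_or_eq (le_sup_left : a ≤ a ⊔ c) (sup_le ha.le hc) with h | h
    · exact absurd (sup_eq_left.mp h) hca
    · exact h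
  refine ⟨?_, ?_, ?_⟩
  · intro a ha
    have ha : a ⋖ x := ha
    refine ⟨?_, ?_⟩
    · exact Subtype.mk_lt_mk.mpr (lt_of_le_of_lt (hle a) ha.lt)
    · rintro ⟨d, c, rfl⟩ h1 h2
      have h1 : π a < π c := h1
      have h2 : π c < x := h2
      by_cases h : π c ≤ a
      · have h3 := hinf _ _ (π c) (hr a)
        rw [inf_eq_left.mpr h1.le, inf_eq_right.mpr h] at h3
        exact absurd (hmin c _ (hequiv.trans h3 (hr c))) (not_le_of_gt h1)
      · have h3 := hsup _ _ (π c) (hr a)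
        rw [sup_eq_right.mpr h1.le, hjoin a _ ha h2.le h] at h3
        exact absurd (hxmin _ h3) (not_le_of_gt h2)
  · intro a ha b hb hab
    have ha : a ⋖ x := ha
    have hb : b ⋖ x := hb
    have hab : π a = π b := congrArg Subtype.val hab
    have hrab : r a b := hequiv.trans (hequiv.symm (hr a)) (hab ▸ hr b)
    by_contra hne
    have hba : ¬ b ≤ a := by
      intro h
      rcases hb.eq_or_eq h ha.le with h' | h'
      · exact hne h'
      · exact ha.lt.ne h'
    have h3 := hsup _ _ b hrab
    rw [hjoin a b ha hb.le hba, sup_idem] at h3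
    exact absurd (hxmin _ (hequiv.symm h3)) (not_le_of_gt hb.lt)
  · rintro ⟨d, c, rfl⟩ hc
    have hlt : π c < x := hc.1
    obtain ⟨a, hca, hax⟩ := exists_le_covBy_of_lt hlt
    refine ⟨a, hax, ?_⟩
    have h3 := hinf _ _ (π c) (hr a)
    rw [inf_eq_right.mpr hca] at h3
    have h4 : π c ≤ π a := (hmin c _ (hequiv.trans h3 (hr c))).trans inf_le_left
    apply Subtype.ext
    by_contra hne
    have h5 : π c < π a := lt_of_le_of_ne h4 (fun h => hne h.symm)
    have h6 : π a < x := lt_of_le_of_lt (hle a) hax.lt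
    exact hc.2 (c := ⟨π a, a, rfl⟩) h5 h6
end

section
/- Let K be a field, Λ a finite-dimensional K-algebra, and 𝒲 a class of finite-dimensional right Λ-modules, closed under isomorphism, such that: (i) for every homomorphism f : A → B with A, B ∈ 𝒲, the kernel of f belongs to 𝒲; and (ii) 𝒲 is closed under extensions (if 0 → A → E → B → 0 is exact with A, B ∈ 𝒲, then E ∈ 𝒲). Let Y be a finite-dimensional Λ-module and let g : Y → C be a homomorphism with C ∈ 𝒲 that is a minimal left 𝒲-approximation, meaning: every homomorphism from Y to a module in 𝒲 factors through g, and every f : C → C satisfying f ∘ g = g is an isomorphism. Then, for every Z ∈ 𝒲: (1) precomposition with g gives a bijection Hom_Λ(C, Z) → Hom_Λ(Y, Z); and (2) the map Ext¹_Λ(C, Z) → Ext¹_Λ(Y, Z) induced by g is injective. (In the paper this is applied with 𝒲 = Filt(𝒳′) for a subset 𝒳′ of the first component of an SM-compatible semibrick pair and Y a member of the second component; the class Filt(𝒳′) of a semibrick 𝒳′ satisfies hypotheses (i) and (ii).) -/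
namespace PaperTors

universe u

variable (K : Type u) [Field K] (Λ : Type u) [Ring Λ] [Algebra K Λ]

/-- Let `𝒲` be an isomorphism-closed class of finite-dimensional right
`Λ`-modules that is closed under kernels of homomorphisms between its members and under
extensions.  Let `g : Y → C` be a minimal left `𝒲`-approximation of `Y`.  Then for every
`Z ∈ 𝒲`:
(1) precomposition with `g` is a bijection `Hom(C, Z) → Hom(Y, Z)`;
(2) the induced map `Ext¹(C, Z) → Ext¹(Y, Z)` is injective, i.e. every short exact sequence
    `0 → Z → E → C → 0` whose pullback along `g` splits (equivalently, such that `g` lifts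
    through `E → C`) is itself split. -/
theorem stmt18 [FiniteDimensional K Λ]
    (𝒲 : Set (RMod Λ))
    (h_iso : ∀ M N : RMod Λ, (M ≃ₗ[Λᵐᵒᵖ] N) → M ∈ 𝒲 → N ∈ 𝒲)
    (h_fd : ∀ M ∈ 𝒲, IsFinDim K Λ M)
    (h_ker : ∀ A ∈ 𝒲, ∀ B ∈ 𝒲, ∀ f : A →ₗ[Λᵐᵒᵖ] B,
      ModuleCat.of Λᵐᵒᵖ (LinearMap.ker f) ∈ 𝒲)
    (h_ext : ∀ (A E B : RMod Λ) (i : A →ₗ[Λᵐᵒᵖ] E) (p : E →ₗ[Λᵐᵒᵖ] B),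
      Function.Injective i → Function.Surjective p → LinearMap.range i = LinearMap.ker p →
      A ∈ 𝒲 → B ∈ 𝒲 → E ∈ 𝒲)
    (Y : RMod Λ) (hY : IsFinDim K Λ Y)
    (C : RMod Λ) (hC : C ∈ 𝒲) (g : Y →ₗ[Λᵐᵒᵖ] C)
    (h_approx : ∀ D ∈ 𝒲, ∀ f : Y →ₗ[Λᵐᵒᵖ] D, ∃ f' : C →ₗ[Λᵐᵒᵖ] D, f'.comp g = f)
    (h_min : ∀ e : C →ₗ[Λᵐᵒᵖ] C, e.comp g = g → Function.Bijective e)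
    (Z : RMod Λ) (hZ : Z ∈ 𝒲) :
    Function.Bijective (fun φ : C →ₗ[Λᵐᵒᵖ] Z => φ.comp g) ∧
    (∀ (E : RMod Λ) (i : Z →ₗ[Λᵐᵒᵖ] E) (p : E →ₗ[Λᵐᵒᵖ] C),
      Function.Injective i → Function.Surjective p → LinearMap.range i = LinearMap.ker p →
      (∃ h : Y →ₗ[Λᵐᵒᵖ] E, p.comp h = g) →
      ∃ s : C →ₗ[Λᵐᵒᵖ] E, p.comp s = LinearMap.id) := by
  refine ⟨⟨?_, fun f => h_approx Z hZ f⟩, ?_⟩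
  · intro φ ψ hφψ
    have hφψ' : φ.comp g = ψ.comp g := hφψ
    have hmem : ∀ y, g y ∈ LinearMap.ker (φ - ψ) := by
      intro y
      have := LinearMap.congr_fun hφψ' y
      simp only [LinearMap.comp_apply] at this
      simp [this]
    obtain ⟨f', hf'⟩ := h_approx _ (h_ker C hC Z hZ (φ - ψ))
      (LinearMap.codRestrict (LinearMap.ker (φ - ψ)) g hmem)
    have hb := h_min ((LinearMap.ker (φ - ψ)).subtype.comp f') (by
      ext y
      have := LinearMap.congr_fun hf' y
      exact congrArg Subtype.val this)
    ext c
    obtain ⟨d, rfl⟩ := hb.2 c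
    have h0 : (φ - ψ) (f' d).1 = 0 := (f' d).2
    exact sub_eq_zero.mp h0
  · rintro E i p hi hp hip ⟨h, hh⟩
    obtain ⟨h', hh'⟩ := h_approx E (h_ext Z E C i p hi hp hip hZ hC) h
    have hb := h_min (p.comp h') (by rw [LinearMap.comp_assoc, hh', hh])
    let e := LinearEquiv.ofBijective (p.comp h') hb
    refine ⟨h'.comp e.symm.toLinearMap, ?_⟩
    ext c
    exact e.apply_symm_apply c

end PaperTors
end
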